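/- arXiv:1312.1844 — 2 statements merged into one kernel-verified Lean document; each statement's English description precedes it below -/
import Mathlib

section
/- Let g be a prime with g > k(k+2r−1)/3 + 1 and g > 2k+2r−1. Set N := k(k+2r−1) and w := ((g−1)!·2^{g−1})^k · P_k ∈ ℚ[α,β,γ]. For each integer j ≥ 0 let M_j ∈ ℚ be the coefficient of the monomial α^{N−2j}·β^j·γ^0 in w if 2j ≤ N, and M_j := 0 otherwise. Let φ : ℚ → 𝔽_g be the unique ring homomorphism into the field with g elements, and define q(β) := Σ_{i=0}^{(g−3)/2} (φ(M_i) + φ(M_{i+(g−1)/2}) + φ(M_{i+g−1}))·β^i ∈ 𝔽_g[β]. Then q is not the zero polynomial, and there exist k+r−1 pairwise distinct nonzero elements of 𝔽_g that are roots of q. -/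
open Polynomial in
noncomputable def pB10 (r m : ℕ) : Polynomial ℤ := (1 + (m : Polynomial ℤ) * X) ^ (m + 1 - r)

open Polynomial in
noncomputable def pA10 (r m : ℕ) : Polynomial ℤ :=
  (1 + ((m : Polynomial ℤ) + 1) * X) ^ (r + m) * (1 + (m : Polynomial ℤ) * X) ^ (r - 1 - m)

open Polynomial in
lemma mul_deriv_pow10 (p : Polynomial ℤ) (a : ℕ) :
    p * derivative (p ^ a) = (a : Polynomial ℤ) * derivative p * p ^ a := by
  cases a with
  | zero => simp
  | succ a => rw [derivative_pow_succ]; simp; ring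

open Polynomial in
lemma deriv_pB10 (r m : ℕ) :
    (1 + ((m : Polynomial ℤ) + 1) * X) * (1 + (m : Polynomial ℤ) * X) * derivative (pB10 r m)
      = ((m + 1 - r : ℕ) : Polynomial ℤ) * (m : Polynomial ℤ) * (1 + ((m : Polynomial ℤ) + 1) * X) * pB10 r m := by
  have h := mul_deriv_pow10 (1 + (m : Polynomial ℤ) * X) (m + 1 - r)
  have h2 : derivative (1 + (m : Polynomial ℤ) * X) = (m : Polynomial ℤ) := by simp
  rw [h2] at h
  unfold pB10
  linear_combination (1 + ((m : Polynomial ℤ) + 1) * X) * h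

open Polynomial in
lemma deriv_pA10 (r m : ℕ) :
    (1 + ((m : Polynomial ℤ) + 1) * X) * (1 + (m : Polynomial ℤ) * X) * derivative (pA10 r m)
      = (((r + m : ℕ) : Polynomial ℤ) * ((m : Polynomial ℤ) + 1) * (1 + (m : Polynomial ℤ) * X)
        + ((r - 1 - m : ℕ) : Polynomial ℤ) * (m : Polynomial ℤ) * (1 + ((m : Polynomial ℤ) + 1) * X)) * pA10 r m := by
  have h := mul_deriv_pow10 (1 + (m : Polynomial ℤ) * X) (r - 1 - m)
  have h2 : derivative (1 + (m : Polynomial ℤ) * X) = (m : Polynomial ℤ) := by simp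
  rw [h2] at h
  have h' := mul_deriv_pow10 (1 + ((m : Polynomial ℤ) + 1) * X) (r + m)
  have h2' : derivative (1 + ((m : Polynomial ℤ) + 1) * X) = (m : Polynomial ℤ) + 1 := by simp
  rw [h2'] at h'
  unfold pA10
  rw [derivative_mul]
  linear_combination (1 + ((m : Polynomial ℤ) + 1) * X) * (1 + ((m : Polynomial ℤ) + 1) * X) ^ (r + m) * h
    + (1 + (m : Polynomial ℤ) * X) * (1 + (m : Polynomial ℤ) * X) ^ (r - 1 - m) * h'

lemma exists_series10 (r m : ℕ) : ∃ G : PowerSeries ℤ,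
    (pB10 r m : PowerSeries ℤ) * G = (pA10 r m : PowerSeries ℤ) ∧ PowerSeries.coeff 0 G = 1 := by
  have hB : PowerSeries.constantCoeff (pB10 r m : PowerSeries ℤ) = ((1 : ℤˣ) : ℤ) := by
    simp [pB10]
  refine ⟨PowerSeries.invOfUnit (pB10 r m : PowerSeries ℤ) 1 * (pA10 r m : PowerSeries ℤ), ?_, ?_⟩
  · rw [← mul_assoc, PowerSeries.mul_invOfUnit _ _ hB, one_mul]
  · simp [pA10]

lemma coe_nat10 (n : ℕ) : (((n : ℕ) : Polynomial ℤ) : PowerSeries ℤ) = (n : PowerSeries ℤ) :=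
  map_natCast (Polynomial.coeToPowerSeries.ringHom (R := ℤ)) n

lemma series_ode10 (r m : ℕ) (_hr : 1 ≤ r) (G : PowerSeries ℤ)
    (hG : (pB10 r m : PowerSeries ℤ) * G = (pA10 r m : PowerSeries ℤ)) :
    (1 + ((m : PowerSeries ℤ) + 1) * PowerSeries.X) * (1 + (m : PowerSeries ℤ) * PowerSeries.X)
        * PowerSeries.derivative ℤ G
      = ((r : PowerSeries ℤ) * (2 * (m : PowerSeries ℤ) + 1) + (2 * (r : PowerSeries ℤ) - 1)
        * ((m : PowerSeries ℤ) * ((m : PowerSeries ℤ) + 1)) * PowerSeries.X) * G := by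
  have hB0 : (pB10 r m : PowerSeries ℤ) ≠ 0 := by
    intro h
    have := congrArg PowerSeries.constantCoeff h
    simp [pB10] at this
  have hA := congrArg (fun p : Polynomial ℤ => (p : PowerSeries ℤ)) (deriv_pA10 r m)
  have hB := congrArg (fun p : Polynomial ℤ => (p : PowerSeries ℤ)) (deriv_pB10 r m)
  have hD := congrArg (PowerSeries.derivative ℤ) hG
  simp only [Derivation.leibniz, PowerSeries.derivative_coe, smul_eq_mul] at hD
  simp only [Polynomial.coe_mul, Polynomial.coe_add, Polynomial.coe_one, Polynomial.coe_X, 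
    coe_nat10] at hA hB
  have hs : ((r - 1 - m : ℕ) : PowerSeries ℤ) - ((m + 1 - r : ℕ) : PowerSeries ℤ)
     = (r : PowerSeries ℤ) - 1 - m := by
    rcases le_total r (m + 1) with h | h
    · have : r - 1 - m = 0 := by omega
      rw [this, Nat.cast_sub h]; push_cast; ring
    · have : m + 1 - r = 0 := by omega
      rw [this, Nat.sub_sub, Nat.cast_sub (by omega)]; push_cast; ring
  apply mul_left_cancel₀ hB0
  push_cast at hA
  linear_combination (1 + ((m : PowerSeries ℤ) + 1) * PowerSeries.X) * (1 + (m : PowerSeries ℤ) * PowerSeries.X) * hD + hA - hB * G 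
    - ((r+m) * (m + 1) * (1 + (m : PowerSeries ℤ) * PowerSeries.X)
        + ((r - 1 - m : ℕ) : PowerSeries ℤ) * m * (1 + ((m : PowerSeries ℤ) + 1) * PowerSeries.X)) * hG
    + m * (1 + ((m : PowerSeries ℤ) + 1) * PowerSeries.X) * (pB10 r m : PowerSeries ℤ) * G * hs

/-- integer-indexed coefficients -/
noncomputable def fc10 (G : PowerSeries ℤ) (n : ℤ) : ℤ := if n < 0 then 0 else PowerSeries.coeff n.toNat G

lemma fc10_neg (G : PowerSeries ℤ) (n : ℤ) (h : n < 0) : fc10 G n = 0 := by simp [fc10, h]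

lemma fc10_nat (G : PowerSeries ℤ) (n : ℕ) : fc10 G n = PowerSeries.coeff n G := by simp [fc10]

lemma fc10_rec_aux (G : PowerSeries ℤ) (a d e f : ℤ)
    (h' : PowerSeries.derivative ℤ G + PowerSeries.C a * (PowerSeries.X * PowerSeries.derivative ℤ G)
      + PowerSeries.C d * (PowerSeries.X * (PowerSeries.X * PowerSeries.derivative ℤ G))
      = PowerSeries.C e * G + PowerSeries.C f * (PowerSeries.X * G)) (n : ℤ) :
    (n + 1) * fc10 G (n + 1) + a * n * fc10 G n + d * (n - 1) * fc10 G (n - 1)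
      = e * fc10 G n + f * fc10 G (n - 1) := by
  rcases lt_trichotomy n (-1) with hn | hn | hn
  · rw [fc10_neg _ (n + 1) (by omega), fc10_neg _ n (by omega), fc10_neg _ (n - 1) (by omega)]; ring
  · subst hn
    rw [fc10_neg _ (-1) (by omega), fc10_neg _ (-1 - 1) (by omega)]; ring
  · obtain ⟨N, rfl⟩ : ∃ N : ℕ, n = N := ⟨n.toNat, by omega⟩
    have hc := congrArg (PowerSeries.coeff N) h'
    rcases N with _ | _ | N
    · have e1 := fc10_nat G 1
      have e0 := fc10_nat G 0
      have em := fc10_neg G (-1) (by omega)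
      simp only [map_add, PowerSeries.coeff_C_mul, PowerSeries.coeff_derivative, PowerSeries.coeff_zero_X_mul] at hc
      simp only [Nat.cast_zero, Nat.cast_one, zero_add, zero_sub] at e1 e0 hc ⊢
      rw [e1, e0, em]
      linear_combination hc
    · have e1 := fc10_nat G 2
      have e0 := fc10_nat G 1
      have em := fc10_nat G 0
      simp only [map_add, PowerSeries.coeff_C_mul, PowerSeries.coeff_derivative, PowerSeries.coeff_succ_X_mul,
        PowerSeries.coeff_zero_X_mul] at hc
      norm_num only [zero_add, Nat.cast_one, Nat.cast_ofNat, Nat.cast_zero] at e1 e0 em hc ⊢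
      rw [e1, e0, em]
      linear_combination hc
    · have e1 := fc10_nat G (N + 3)
      have e0 := fc10_nat G (N + 2)
      have em := fc10_nat G (N + 1)
      simp only [map_add, PowerSeries.coeff_C_mul, PowerSeries.coeff_derivative, PowerSeries.coeff_succ_X_mul] at hc
      have q1 : ((N + 1 + 1 : ℕ) : ℤ) + 1 = ((N + 3 : ℕ) : ℤ) := by push_cast; ring
      have q2 : ((N + 1 + 1 : ℕ) : ℤ) - 1 = ((N + 1 : ℕ) : ℤ) := by push_cast; ring
      have q3 : ((N + 1 + 1 : ℕ) : ℤ)  = ((N + 2 : ℕ) : ℤ) := by push_cast; ring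
      rw [q1, q2, q3, e1, e0, em]
      push_cast at hc ⊢
      linear_combination hc

lemma fc10_rec (r m : ℕ) (G : PowerSeries ℤ)
    (h : (1 + ((m : PowerSeries ℤ) + 1) * PowerSeries.X) * (1 + (m : PowerSeries ℤ) * PowerSeries.X)
        * PowerSeries.derivative ℤ G
      = ((r : PowerSeries ℤ) * (2 * (m : PowerSeries ℤ) + 1) + (2 * (r : PowerSeries ℤ) - 1)
        * ((m : PowerSeries ℤ) * ((m : PowerSeries ℤ) + 1)) * PowerSeries.X) * G) (n : ℤ) :
    (n + 1) * fc10 G (n + 1) + (2 * m + 1) * n * fc10 G n + m * (m + 1) * (n - 1) * fc10 G (n - 1)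
      = r * (2 * m + 1) * fc10 G n + (2 * r - 1) * (m * (m + 1)) * fc10 G (n - 1) := by
  apply fc10_rec_aux
  simp only [map_add, map_mul, map_sub, map_natCast, map_one, map_ofNat]
  linear_combination h

open MvPolynomial in
lemma eval_c10 (r m : ℕ) (hr : 1 ≤ r) (G : PowerSeries ℤ)
    (hG : (pB10 r m : PowerSeries ℤ) * G = (pA10 r m : PowerSeries ℤ)) (hG0 : PowerSeries.coeff 0 G = 1)
    (c : ℤ → MvPolynomial (Fin 3) ℚ)
    (hneg : ∀ n : ℤ, n < 0 → c n = 0) (h0 : c 0 = 1)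
    (hrec : ∀ n : ℤ, -3 ≤ n →
      C ((n : ℚ) + 4) * c (n + 4)
      + C (2 * (n : ℚ) + 6 - r) * X 0 * c (n + 3)
      + (C ((n : ℚ) + 2 - r) * (X 0) ^ 2
          + C ((2 * (n : ℚ) + 5 - 2 * r) / 4) * ((X 0) ^ 2 - X 1)) * c (n + 2)
      + (C ((2 * (n : ℚ) + 3 - 3 * r) / 4) * X 0 * ((X 0) ^ 2 - X 1)
          + C (1 / 2 : ℚ) * X 2) * c (n + 1)
      + C (((n : ℚ) + 1 - 2 * r) / 16) * ((X 0) ^ 2 - X 1) ^ 2 * c n = 0) (n : ℤ) :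
    eval ![(2 * m + 1 : ℚ), 1, 0] (c n) = (fc10 G n : ℚ) := by
  have hL := fc10_rec r m G (series_ode10 r m hr G hG)
  have key : ∀ N : ℕ, ∀ n : ℤ, n ≤ N → eval ![(2 * m + 1 : ℚ), 1, 0] (c n) = (fc10 G n : ℚ) := by
    intro N
    induction N with
    | zero =>
      intro n hn
      rcases lt_or_eq_of_le hn with h | h
      · rw [hneg n (by simpa using h), fc10_neg _ _ (by simpa using h)]; simp
      · have : n = 0 := by simpa using h
        subst this
        have := fc10_nat G 0
        simp at this
        rw [h0, this]; rw [PowerSeries.coeff_zero_eq_constantCoeff_apply] at hG0; simp [hG0]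
    | succ N ih =>
      intro n hn
      rcases lt_or_eq_of_le hn with h | h
      · exact ih n (by push_cast at h; omega)
      · obtain ⟨l, rfl⟩ : ∃ l : ℤ, n = l + 4 := ⟨n - 4, by ring⟩
        have hl := hrec l (by push_cast at h; omega)
        have he := congrArg (eval ![(2 * m + 1 : ℚ), 1, 0]) hl
        simp only [map_add, map_mul, map_sub, map_pow, eval_C, eval_X, map_zero] at he
        rw [ih (l + 3) (by push_cast at h; omega), ih (l + 2) (by push_cast at h; omega), 
          ih (l + 1) (by push_cast at h; omega), ih l (by push_cast at h; omega)] at he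
        simp at he
        have L3 := congrArg (Int.cast : ℤ → ℚ) (hL (l + 3))
        have L2 := congrArg (Int.cast : ℤ → ℚ) (hL (l + 2))
        have L1 := congrArg (Int.cast : ℤ → ℚ) (hL (l + 1))
        have hp : ((l : ℚ) + 4) ≠ 0 := by
          have : (0 : ℤ) < l + 4 := by rw [h]; positivity
          exact_mod_cast this.ne'
        have r1 : l + 3 + 1 = l + 4 := by ring
        have r2 : l + 3 - 1 = l + 2 := by ring
        have r3 : l + 2 + 1 = l + 3 := by ring
        have r4 : l + 2 - 1 = l + 1 := by ring
        have r5 : l + 1 + 1 = l + 2 := by ring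
        have r6 : l + 1 - 1 = l := by ring
        rw [r1, r2] at L3
        rw [r3, r4] at L2
        rw [r5, r6] at L1
        push_cast at L1 L2 L3
        apply mul_left_cancel₀ hp
        linear_combination he - L3 - (2 * m + 1) * L2 - m * (m + 1) * L1
  exact key n.toNat n (by omega)

lemma coeff_conv10 {R : Type*} [CommRing R] (k : ℕ) (B : Polynomial R) (hB : ∀ n, k ≤ n → B.coeff n = 0)
    (G : PowerSeries R) (n : ℕ) (hn : k ≤ n + 1) :
    PowerSeries.coeff n ((B : PowerSeries R) * G)
      = ∑ j : Fin k, B.coeff (k - 1 - j.val) * PowerSeries.coeff (n - (k - 1 - j.val)) G := by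
  rw [PowerSeries.coeff_mul, Finset.Nat.sum_antidiagonal_eq_sum_range_succ_mk,
    Fin.sum_univ_eq_sum_range (fun j => B.coeff (k - 1 - j) * PowerSeries.coeff (n - (k - 1 - j)) G) k,
    Finset.sum_range_reflect (fun e => B.coeff e * PowerSeries.coeff (n - e) G) k]
  symm
  simp only [Polynomial.coeff_coe]
  apply Finset.sum_subset
  · intro x; simp; omega
  · intro x _ hx
    rw [hB x (by simpa using hx), zero_mul]

open Polynomial in
lemma pB10_deg (r m : ℕ) : (pB10 r m).natDegree ≤ m + 1 - r := by
  unfold pB10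
  refine natDegree_pow_le.trans ?_
  have : (1 + (m : Polynomial ℤ) * X).natDegree ≤ 1 := by
    rw [← C_eq_natCast]; compute_degree
  nlinarith

open Polynomial in
lemma pA10_deg (r m : ℕ) : (pA10 r m).natDegree ≤ (r + m) + (r - 1 - m) := by
  unfold pA10
  refine natDegree_mul_le.trans ?_
  have h1 : (1 + (m : Polynomial ℤ) * X).natDegree ≤ 1 := by
    rw [← C_eq_natCast]; compute_degree
  have h2 : (1 + ((m : Polynomial ℤ) + 1) * X).natDegree ≤ 1 := by
    have : (m : Polynomial ℤ) + 1 = C ((m : ℤ) + 1) := by simp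
    rw [this]; compute_degree
  have h3 : ((1 + ((m : Polynomial ℤ) + 1) * X) ^ (r + m)).natDegree ≤ r + m := by
    refine natDegree_pow_le.trans ?_
    nlinarith
  have h4 : ((1 + (m : Polynomial ℤ) * X) ^ (r - 1 - m)).natDegree ≤ r - 1 - m := by
    refine natDegree_pow_le.trans ?_
    nlinarith
  omega

lemma det_zero10 (r k m : ℕ) (hr : 1 ≤ r) (hk : 1 ≤ k) (hm : m + 1 - r < k) (G : PowerSeries ℤ)
    (hG : (pB10 r m : PowerSeries ℤ) * G = (pA10 r m : PowerSeries ℤ)) :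
    Matrix.det (Matrix.of fun i j : Fin k =>
      PowerSeries.coeff (k + 2 * r - 1 + j.val - i.val) G) = 0 := by
  rw [← Matrix.exists_mulVec_eq_zero_iff]
  refine ⟨fun j => (pB10 r m).coeff (k - 1 - j.val), ?_, ?_⟩
  · intro h
    have := congrFun h ⟨k - 1, by omega⟩
    simp [pB10, Polynomial.coeff_zero_eq_eval_zero] at this
  · funext i
    have hi := i.isLt
    have := coeff_conv10 k (pB10 r m) 
      (fun n hn => Polynomial.coeff_eq_zero_of_natDegree_lt ((pB10_deg r m).trans_lt (by omega))) G
      (k + 2 * r - 1 + (k - 1) - i.val) (by omega)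
    rw [hG, Polynomial.coeff_coe, Polynomial.coeff_eq_zero_of_natDegree_lt ((pA10_deg r m).trans_lt (by omega))] at this
    simp only [Matrix.mulVec, dotProduct, Matrix.of_apply, Pi.zero_apply]
    rw [this]
    apply Finset.sum_congr rfl
    intro j _
    have hj := j.isLt
    rw [mul_comm]
    congr 3
    omega

open Polynomial in
lemma det_ne_zero10 {F : Type*} [Field F] (k p : ℕ) (hkp : k ≤ p) (A B : Polynomial F)
    (hA : A.natDegree ≤ p) (hB : B.natDegree = k) (hB0 : B ≠ 0) (hAB : IsCoprime B A) (G : PowerSeries F)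
    (hG : (B : PowerSeries F) * G = (A : PowerSeries F)) :
    Matrix.det (Matrix.of fun i j : Fin k =>
      PowerSeries.coeff (p + j.val - i.val) G) ≠ 0 := by
  intro hdet
  rw [← Matrix.exists_mulVec_eq_zero_iff] at hdet
  obtain ⟨y, hy0, hy⟩ := hdet
  have hk : 0 < k := by
    rcases Nat.eq_zero_or_pos k with rfl | h
    · exact absurd (Subsingleton.elim y 0) hy0
    · exact h
  set Y : Polynomial F := ∑ j : Fin k, C (y j) * X ^ (k - 1 - j.val) with hY
  have hYc : ∀ j : Fin k, Y.coeff (k - 1 - j.val) = y j := by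
    intro j
    rw [hY, finsetSum_coeff]
    rw [Finset.sum_eq_single j]
    · simp
    · intro b _ hb
      rw [coeff_C_mul_X_pow, if_neg]
      intro h
      apply hb
      ext
      omega
    · simp
  have hYd : ∀ n, k ≤ n → Y.coeff n = 0 := by
    intro n hn
    rw [hY, finsetSum_coeff]
    apply Finset.sum_eq_zero
    intro j _
    rw [coeff_C_mul_X_pow, if_neg]
    omega
  have hH : ∀ n, p ≤ n → n < p + k → PowerSeries.coeff n ((Y : PowerSeries F) * G) = 0 := by
    intro n h1 h2
    rw [coeff_conv10 k Y hYd G n (by omega)]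
    have := congrFun hy ⟨p + k - 1 - n, by omega⟩
    simp only [Matrix.mulVec, dotProduct, Matrix.of_apply, Pi.zero_apply] at this
    rw [← this]
    apply Finset.sum_congr rfl
    intro j _
    rw [hYc, mul_comm]
    congr 3
    omega
  set Z : Polynomial F := PowerSeries.trunc p ((Y : PowerSeries F) * G) with hZ
  have hdiv : (PowerSeries.X : PowerSeries F) ^ (p + k) ∣ (Y : PowerSeries F) * G - (Z : PowerSeries F) := by
    rw [PowerSeries.X_pow_dvd_iff]
    intro n hn
    rw [map_sub, Polynomial.coeff_coe, hZ, PowerSeries.coeff_trunc]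
    split_ifs with h
    · simp
    · rw [hH n (by omega) hn]; simp
  have hdiv2 : (PowerSeries.X : PowerSeries F) ^ (p + k) ∣ ((A * Y - B * Z : Polynomial F) : PowerSeries F) := by
    have : ((A * Y - B * Z : Polynomial F) : PowerSeries F) 
       = (B : PowerSeries F) * ((Y : PowerSeries F) * G - (Z : PowerSeries F)) := by
      rw [Polynomial.coe_sub, Polynomial.coe_mul, Polynomial.coe_mul, ← hG]; ring
    rw [this]
    exact hdiv.mul_left _
  rw [PowerSeries.X_pow_dvd_iff] at hdiv2
  have hYn : Y.natDegree ≤ k - 1 := by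
    rw [natDegree_le_iff_coeff_eq_zero]
    intro n hn
    exact hYd n (by omega)
  have hZn : Z.natDegree ≤ p - 1 := by
    rw [natDegree_le_iff_coeff_eq_zero]
    intro n hn
    rw [hZ, PowerSeries.coeff_trunc, if_neg (by omega)]
  have hzero : A * Y - B * Z = 0 := by
    ext n
    by_cases hn : n < p + k
    · have := hdiv2 n hn
      rw [Polynomial.coeff_coe] at this
      rw [this]; simp
    · rw [coeff_sub, coeff_eq_zero_of_natDegree_lt (p := A * Y) (natDegree_mul_le.trans_lt (by omega)),
        coeff_eq_zero_of_natDegree_lt (p := B * Z) (natDegree_mul_le.trans_lt (by omega))]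
      simp
  have hBY : B ∣ Y := hAB.dvd_of_dvd_mul_left ⟨Z, sub_eq_zero.mp hzero⟩
  have hY0 : Y = 0 := by
    by_contra h
    have := natDegree_le_of_dvd hBY h
    omega
  apply hy0
  funext j
  rw [← hYc j, hY0]; simp

open Polynomial in
lemma det_ne_zero_mod10 (r k g : ℕ) [Fact g.Prime] (hr : 1 ≤ r) (hk : 1 ≤ k) (hg : 2 * k + 2 * r - 1 < g)
    (G : PowerSeries ℤ)
    (hG : (pB10 r (r + k - 1) : PowerSeries ℤ) * G = (pA10 r (r + k - 1) : PowerSeries ℤ)) :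
    ((Matrix.det (Matrix.of fun i j : Fin k =>
      PowerSeries.coeff (k + 2 * r - 1 + j.val - i.val) G) : ℤ) : ZMod g) ≠ 0 := by
  set φ := Int.castRingHom (ZMod g) with hφ
  have hm0 : ((r + k - 1 : ℕ) : ZMod g) ≠ 0 := by
    rw [Ne, ZMod.natCast_eq_zero_iff]
    exact fun h => by have := Nat.le_of_dvd (by omega) h; omega
  have hBe : (pB10 r (r + k - 1)).map φ = (1 + C ((r + k - 1 : ℕ) : ZMod g) * X) ^ k := by
    unfold pB10
    rw [show r + k - 1 + 1 - r = k by omega]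
    simp
  have hAe : (pA10 r (r + k - 1)).map φ = (1 + (C ((r + k - 1 : ℕ) : ZMod g) + 1) * X) ^ (2 * r + k - 1) := by
    unfold pA10
    rw [show r - 1 - (r + k - 1) = 0 by omega, show r + (r + k - 1) = 2 * r + k - 1 by omega]
    simp
  have key := det_ne_zero10 (F := ZMod g) k (k + 2 * r - 1) (by omega) ((pA10 r (r + k - 1)).map φ)
    ((pB10 r (r + k - 1)).map φ) (natDegree_map_le.trans ((pA10_deg r _).trans (by omega))) ?_ ?_ ?_
    (PowerSeries.map φ G) ?_
  · change φ _ ≠ 0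
    rw [RingHom.map_det]
    have e : φ.mapMatrix (Matrix.of fun i j : Fin k =>
        PowerSeries.coeff (k + 2 * r - 1 + j.val - i.val) G) = Matrix.of fun i j : Fin k =>
        PowerSeries.coeff (k + 2 * r - 1 + j.val - i.val) (PowerSeries.map φ G) := by
      ext i j
      simp
    rw [e]
    exact key
  · rw [hBe, natDegree_pow]
    have : (1 + C ((r + k - 1 : ℕ) : ZMod g) * X).natDegree = 1 := by
      rw [add_comm, ← C_1, natDegree_linear hm0]
    rw [this, mul_one]
  · rw [hBe]
    apply pow_ne_zero
    intro h
    have := congrArg (fun p => coeff p 0) h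
    simp at this
  · rw [hAe, hBe]
    apply IsCoprime.pow
    exact ⟨C ((r + k - 1 : ℕ) : ZMod g) + 1, - C ((r + k - 1 : ℕ) : ZMod g), by ring⟩
  · rw [Polynomial.polynomial_map_coe, Polynomial.polynomial_map_coe, ← map_mul, hG]

/-- Rationals with denominator prime to `g`. -/
def Rg10 (g : ℕ) [Fact g.Prime] : Subring ℚ where
  carrier := {x | (x.den : ZMod g) ≠ 0}
  mul_mem' := by
    intro a b ha hb h
    have hd : ((a.den * b.den : ℕ) : ZMod g) = 0 := by
      rw [ZMod.natCast_eq_zero_iff] at h ⊢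
      exact h.trans (Rat.mul_den_dvd a b)
    push_cast at hd
    exact (mul_ne_zero ha hb) hd
  add_mem' := by
    intro a b ha hb h
    have hd : ((a.den * b.den : ℕ) : ZMod g) = 0 := by
      rw [ZMod.natCast_eq_zero_iff] at h ⊢
      exact h.trans (Rat.add_den_dvd a b)
    push_cast at hd
    exact (mul_ne_zero ha hb) hd
  one_mem' := by simp
  zero_mem' := by simp
  neg_mem' := by
    intro a ha
    simpa using ha

noncomputable def phi10 (g : ℕ) [Fact g.Prime] : Rg10 g →+* ZMod g where
  toFun x := ((x : ℚ) : ZMod g)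
  map_one' := by simp
  map_zero' := by simp
  map_mul' x y := Rat.cast_mul_of_ne_zero x.2 y.2
  map_add' x y := Rat.cast_add_of_ne_zero x.2 y.2

lemma inv_mem10 (g : ℕ) [Fact g.Prime] (n : ℕ) (h : (n : ZMod g) ≠ 0) : (1 / (n : ℚ)) ∈ Rg10 g := by
  have hn : n ≠ 0 := by rintro rfl; simp at h
  change (((1 / (n : ℚ)).den : ℕ) : ZMod g) ≠ 0
  rw [one_div, Rat.inv_natCast_den, if_neg hn]
  exact h

lemma div_mem10 (g : ℕ) [Fact g.Prime] (x : ℚ) (hx : x ∈ Rg10 g) (n : ℕ) (h : (n : ZMod g) ≠ 0) : 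
    (x / (n : ℚ)) ∈ Rg10 g := by
  rw [div_eq_mul_one_div]
  exact mul_mem hx (inv_mem10 g n h)

open MvPolynomial in
lemma C_mem10 (g : ℕ) [Fact g.Prime] (x : ℚ) (hx : x ∈ Rg10 g) :
    (C x : MvPolynomial (Fin 3) ℚ) ∈ (MvPolynomial.map (σ := Fin 3) (Rg10 g).subtype).range :=
  ⟨C ⟨x, hx⟩, by simp⟩

open MvPolynomial in
lemma X_mem10 (g : ℕ) [Fact g.Prime] (i : Fin 3) :
    (X i : MvPolynomial (Fin 3) ℚ) ∈ (MvPolynomial.map (σ := Fin 3) (Rg10 g).subtype).range :=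
  ⟨X i, by simp⟩

open MvPolynomial in
lemma coeff_mem10 (g : ℕ) [Fact g.Prime] (p : MvPolynomial (Fin 3) ℚ)
    (hp : p ∈ (MvPolynomial.map (σ := Fin 3) (Rg10 g).subtype).range) (d : Fin 3 →₀ ℕ) :
    coeff d p ∈ Rg10 g := by
  obtain ⟨p, rfl⟩ := hp
  rw [coeff_map]
  exact (coeff d p).2

open MvPolynomial in
lemma c_int10 (r g : ℕ) [Fact g.Prime] (hg : 2 < g)
    (c : ℤ → MvPolynomial (Fin 3) ℚ)
    (hneg : ∀ n : ℤ, n < 0 → c n = 0) (h0 : c 0 = 1)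
    (hrec : ∀ n : ℤ, -3 ≤ n →
      C ((n : ℚ) + 4) * c (n + 4)
      + C (2 * (n : ℚ) + 6 - r) * X 0 * c (n + 3)
      + (C ((n : ℚ) + 2 - r) * (X 0) ^ 2
          + C ((2 * (n : ℚ) + 5 - 2 * r) / 4) * ((X 0) ^ 2 - X 1)) * c (n + 2)
      + (C ((2 * (n : ℚ) + 3 - 3 * r) / 4) * X 0 * ((X 0) ^ 2 - X 1)
          + C (1 / 2 : ℚ) * X 2) * c (n + 1)
      + C (((n : ℚ) + 1 - 2 * r) / 16) * ((X 0) ^ 2 - X 1) ^ 2 * c n = 0) (N : ℕ) :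
    N < g → ∀ n : ℤ, n ≤ N → c n ∈ (MvPolynomial.map (σ := Fin 3) (Rg10 g).subtype).range := by
  have h2 : ((2 : ℕ) : ZMod g) ≠ 0 := by
    rw [Ne, ZMod.natCast_eq_zero_iff]
    exact fun h => by have := Nat.le_of_dvd (by omega) h; omega
  have h4 : ((4 : ℕ) : ZMod g) ≠ 0 := by
    have := mul_ne_zero h2 h2
    rw [← Nat.cast_mul] at this; exact this
  have h16 : ((16 : ℕ) : ZMod g) ≠ 0 := by
    have := mul_ne_zero h4 h4
    rw [← Nat.cast_mul] at this; exact this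
  induction N with
  | zero =>
    intro _ n hn
    rcases lt_or_eq_of_le hn with h | h
    · rw [hneg n (by simpa using h)]; exact zero_mem _
    · have : n = 0 := by simpa using h
      rw [this, h0]; exact one_mem _
  | succ N ih =>
    intro hN n hn
    replace ih := ih (by omega)
    rcases lt_or_eq_of_le hn with h | h
    · exact ih n (by push_cast at h; omega)
    · obtain ⟨l, rfl⟩ : ∃ l : ℤ, n = l + 4 := ⟨n - 4, by ring⟩
      have hl := hrec l (by push_cast at h; omega)
      have hlq : (l : ℚ) + 4 = ((N + 1 : ℕ) : ℚ) := by exact_mod_cast h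
      have hN1 : ((N + 1 : ℕ) : ZMod g) ≠ 0 := by
        rw [Ne, ZMod.natCast_eq_zero_iff]
        exact fun h => by have := Nat.le_of_dvd (by omega) h; omega
      have i3 := ih (l + 3) (by push_cast at h; omega)
      have i2 := ih (l + 2) (by push_cast at h; omega)
      have i1 := ih (l + 1) (by push_cast at h; omega)
      have i0 := ih l (by push_cast at h; omega)
      have hCC : C (1 / ((N + 1 : ℕ) : ℚ)) * C ((N + 1 : ℕ) : ℚ) = (1 : MvPolynomial (Fin 3) ℚ) := by
        rw [← C_mul, one_div, inv_mul_cancel₀ (by positivity), C_1]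
      rw [hlq] at hl
      have hc : c (l + 4) = C (1 / ((N + 1 : ℕ) : ℚ)) * -(
        C (2 * (l : ℚ) + 6 - r) * X 0 * c (l + 3)
        + (C ((l : ℚ) + 2 - r) * (X 0) ^ 2
          + C ((2 * (l : ℚ) + 5 - 2 * r) / 4) * ((X 0) ^ 2 - X 1)) * c (l + 2)
        + (C ((2 * (l : ℚ) + 3 - 3 * r) / 4) * X 0 * ((X 0) ^ 2 - X 1)
          + C (1 / 2 : ℚ) * X 2) * c (l + 1)
        + C (((l : ℚ) + 1 - 2 * r) / 16) * ((X 0) ^ 2 - X 1) ^ 2 * c l) := by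
        linear_combination C (1 / ((N + 1 : ℕ) : ℚ)) * hl - c (l + 4) * hCC
      have z : ∀ a : ℤ, (a : ℚ) ∈ Rg10 g := fun a => intCast_mem _ a
      have k1 : (2 * (l : ℚ) + 6 - r) ∈ Rg10 g := by
        have := z (2 * l + 6 - r); push_cast at this; exact this
      have k2 : ((l : ℚ) + 2 - r) ∈ Rg10 g := by
        have := z (l + 2 - r); push_cast at this; exact this
      have k3 : (2 * (l : ℚ) + 5 - 2 * r) / 4 ∈ Rg10 g := by
        have := div_mem10 g _ (z (2 * l + 5 - 2 * r)) 4 h4; push_cast at this; exact this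
      have k4 : (2 * (l : ℚ) + 3 - 3 * r) / 4 ∈ Rg10 g := by
        have := div_mem10 g _ (z (2 * l + 3 - 3 * r)) 4 h4; push_cast at this; exact this
      have k5 : ((l : ℚ) + 1 - 2 * r) / 16 ∈ Rg10 g := by
        have := div_mem10 g _ (z (l + 1 - 2 * r)) 16 h16; push_cast at this; exact this
      have k6 : (1 / 2 : ℚ) ∈ Rg10 g := by
        have := inv_mem10 g 2 h2; push_cast at this; exact this
      have x0 := X_mem10 g 0
      have x1 := X_mem10 g 1
      have x2 := X_mem10 g 2
      have y := sub_mem (pow_mem x0 2) x1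
      rw [hc]
      refine mul_mem (C_mem10 g _ (inv_mem10 g _ hN1)) (neg_mem (add_mem (add_mem (add_mem ?_ ?_) ?_) ?_))
      · exact mul_mem (mul_mem (C_mem10 g _ k1) x0) i3
      · exact mul_mem (add_mem (mul_mem (C_mem10 g _ k2) (pow_mem x0 2)) (mul_mem (C_mem10 g _ k3) y)) i2
      · exact mul_mem (add_mem (mul_mem (mul_mem (C_mem10 g _ k4) x0) y) (mul_mem (C_mem10 g _ k6) x2)) i1
      · exact mul_mem (mul_mem (C_mem10 g _ k5) (pow_mem y 2)) i0

open MvPolynomial in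
lemma c_hom10 (r : ℕ)
    (c : ℤ → MvPolynomial (Fin 3) ℚ)
    (hneg : ∀ n : ℤ, n < 0 → c n = 0) (h0 : c 0 = 1)
    (hrec : ∀ n : ℤ, -3 ≤ n →
      C ((n : ℚ) + 4) * c (n + 4)
      + C (2 * (n : ℚ) + 6 - r) * X 0 * c (n + 3)
      + (C ((n : ℚ) + 2 - r) * (X 0) ^ 2
          + C ((2 * (n : ℚ) + 5 - 2 * r) / 4) * ((X 0) ^ 2 - X 1)) * c (n + 2)
      + (C ((2 * (n : ℚ) + 3 - 3 * r) / 4) * X 0 * ((X 0) ^ 2 - X 1)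
          + C (1 / 2 : ℚ) * X 2) * c (n + 1)
      + C (((n : ℚ) + 1 - 2 * r) / 16) * ((X 0) ^ 2 - X 1) ^ 2 * c n = 0) (N : ℕ) :
    ∀ n : ℤ, n ≤ N → c n ∈ weightedHomogeneousSubmodule ℚ (![1, 2, 3] : Fin 3 → ℤ) n := by
  induction N with
  | zero =>
    intro n hn
    rcases lt_or_eq_of_le hn with h | h
    · rw [hneg n (by simpa using h)]; exact zero_mem _
    · have : n = 0 := by simpa using h
      rw [this, h0]; exact isWeightedHomogeneous_one _ _
  | succ N ih =>
    intro n hn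
    rcases lt_or_eq_of_le hn with h | h
    · exact ih n (by push_cast at h; omega)
    · obtain ⟨l, rfl⟩ : ∃ l : ℤ, n = l + 4 := ⟨n - 4, by ring⟩
      have hl := hrec l (by push_cast at h; omega)
      have hlq : (l : ℚ) + 4 = ((N + 1 : ℕ) : ℚ) := by exact_mod_cast h
      have i3 := ih (l + 3) (by push_cast at h; omega)
      have i2 := ih (l + 2) (by push_cast at h; omega)
      have i1 := ih (l + 1) (by push_cast at h; omega)
      have i0 := ih l (by push_cast at h; omega)
      have hCC : C (1 / ((N + 1 : ℕ) : ℚ)) * C ((N + 1 : ℕ) : ℚ) = (1 : MvPolynomial (Fin 3) ℚ) := by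
        rw [← C_mul, one_div, inv_mul_cancel₀ (by positivity), C_1]
      rw [hlq] at hl
      have hc : c (l + 4) = C (1 / ((N + 1 : ℕ) : ℚ)) * -(
        C (2 * (l : ℚ) + 6 - r) * X 0 * c (l + 3)
        + (C ((l : ℚ) + 2 - r) * (X 0) ^ 2
          + C ((2 * (l : ℚ) + 5 - 2 * r) / 4) * ((X 0) ^ 2 - X 1)) * c (l + 2)
        + (C ((2 * (l : ℚ) + 3 - 3 * r) / 4) * X 0 * ((X 0) ^ 2 - X 1)
          + C (1 / 2 : ℚ) * X 2) * c (l + 1)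
        + C (((l : ℚ) + 1 - 2 * r) / 16) * ((X 0) ^ 2 - X 1) ^ 2 * c l) := by
        linear_combination C (1 / ((N + 1 : ℕ) : ℚ)) * hl - c (l + 4) * hCC
      have x0 : IsWeightedHomogeneous (![1, 2, 3] : Fin 3 → ℤ) (X 0 : MvPolynomial (Fin 3) ℚ) 1 :=
        isWeightedHomogeneous_X _ _ _
      have x1 : IsWeightedHomogeneous (![1, 2, 3] : Fin 3 → ℤ) (X 1 : MvPolynomial (Fin 3) ℚ) 2 :=
        isWeightedHomogeneous_X _ _ _
      have x2 : IsWeightedHomogeneous (![1, 2, 3] : Fin 3 → ℤ) (X 2 : MvPolynomial (Fin 3) ℚ) 3 :=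
        isWeightedHomogeneous_X _ _ _
      have y0 : IsWeightedHomogeneous (![1, 2, 3] : Fin 3 → ℤ) ((X 0) ^ 2 : MvPolynomial (Fin 3) ℚ) 2 := by
        simpa using x0.pow 2
      have y : IsWeightedHomogeneous (![1, 2, 3] : Fin 3 → ℤ) ((X 0) ^ 2 - X 1 : MvPolynomial (Fin 3) ℚ) 2 :=
        Submodule.sub_mem (weightedHomogeneousSubmodule ℚ (![1, 2, 3] : Fin 3 → ℤ) 2) y0 x1
      have yy : IsWeightedHomogeneous (![1, 2, 3] : Fin 3 → ℤ) (((X 0) ^ 2 - X 1) ^ 2 : MvPolynomial (Fin 3) ℚ) 4 := by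
        simpa using y.pow 2
      have Cm : ∀ (a : ℚ) (d : ℤ) (p : MvPolynomial (Fin 3) ℚ), 
          IsWeightedHomogeneous (![1, 2, 3] : Fin 3 → ℤ) p d → 
          IsWeightedHomogeneous (![1, 2, 3] : Fin 3 → ℤ) (C a * p) d := by
        intro a d p hp
        rw [← smul_eq_C_mul]
        exact Submodule.smul_mem (weightedHomogeneousSubmodule ℚ (![1, 2, 3] : Fin 3 → ℤ) d) a hp
      have Mm : ∀ (d e f : ℤ) (p q : MvPolynomial (Fin 3) ℚ), 
          IsWeightedHomogeneous (![1, 2, 3] : Fin 3 → ℤ) p d → 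
          IsWeightedHomogeneous (![1, 2, 3] : Fin 3 → ℤ) q e → d + e = f →
          IsWeightedHomogeneous (![1, 2, 3] : Fin 3 → ℤ) (p * q) f := by
        intro d e f p q hp hq h
        rw [← h]
        exact hp.mul hq
      rw [hc]
      refine Cm _ _ _ ?_
      change _ ∈ weightedHomogeneousSubmodule ℚ (![1, 2, 3] : Fin 3 → ℤ) (l + 4)
      refine neg_mem (add_mem (add_mem (add_mem ?_ ?_) ?_) ?_)
      · exact Mm 1 (l + 3) _ _ _ (Cm _ _ _ x0) i3 (by ring)
      · exact Mm 2 (l + 2) _ _ _ (Submodule.add_mem (weightedHomogeneousSubmodule ℚ (![1, 2, 3] : Fin 3 → ℤ) 2)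
          (Cm _ _ _ y0) (Cm _ _ _ y)) i2 (by ring)
      · exact Mm 3 (l + 1) _ _ _ (Submodule.add_mem (weightedHomogeneousSubmodule ℚ (![1, 2, 3] : Fin 3 → ℤ) 3)
          (Mm 1 2 3 _ _ (Cm _ _ _ x0) y (by ring)) (Cm _ _ _ x2)) i1 (by ring)
      · exact Mm 4 l _ _ _ (Cm _ _ _ yy) i0 (by ring)

open MvPolynomial in
lemma det_hom10 (k : ℕ) (s : ℤ) (c : ℤ → MvPolynomial (Fin 3) ℚ)
    (hc : ∀ n : ℤ, c n ∈ weightedHomogeneousSubmodule ℚ (![1, 2, 3] : Fin 3 → ℤ) n) :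
    Matrix.det (Matrix.of fun i j : Fin k => c (s + j.val - i.val)) ∈
      weightedHomogeneousSubmodule ℚ (![1, 2, 3] : Fin 3 → ℤ) (k * s) := by
  rw [Matrix.det_apply]
  apply Submodule.sum_mem
  intro σ _
  have : IsWeightedHomogeneous (![1, 2, 3] : Fin 3 → ℤ) (∏ i : Fin k, c (s + i.val - (σ i).val))
      (∑ i : Fin k, (s + i.val - (σ i).val)) :=
    IsWeightedHomogeneous.prod _ _ _ (fun i _ => hc _)
  have e : ∑ i : Fin k, (s + (i.val : ℤ) - ((σ i).val : ℤ)) = k * s := by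
    rw [Finset.sum_sub_distrib, Finset.sum_add_distrib, Equiv.sum_comp σ (fun i : Fin k => (i.val : ℤ))]
    simp
  rw [e] at this
  rw [Units.smul_def]
  exact zsmul_mem this _

open MvPolynomial in
lemma eval_w10 (N : ℕ) (w : MvPolynomial (Fin 3) ℚ)
    (hw : IsWeightedHomogeneous (![1, 2, 3] : Fin 3 → ℤ) w (N : ℤ)) (t : ℚ) :
    eval ![t, 1, 0] w = ∑ j ∈ Finset.range (N / 2 + 1),
      coeff (Finsupp.single (0 : Fin 3) (N - 2 * j) + Finsupp.single (1 : Fin 3) j) w * t ^ (N - 2 * j) := by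
  rw [eval_eq']
  have hwt : ∀ d : Fin 3 →₀ ℕ, coeff d w ≠ 0 → d 0 + 2 * d 1 + 3 * d 2 = N := by
    intro d hd
    have := hw hd
    rw [Finsupp.weight_apply, Finsupp.sum_fintype _ _ (by simp), Fin.sum_univ_three] at this
    simp at this
    omega
  symm
  apply Finset.sum_bij_ne_zero 
    (fun j _ _ => Finsupp.single (0 : Fin 3) (N - 2 * j) + Finsupp.single (1 : Fin 3) j)
  · intro j _ h
    rw [mem_support_iff]
    exact left_ne_zero_of_mul h
  · intro a _ _ b _ _ h
    have := DFunLike.congr_fun h 1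
    simpa using this
  · intro d hd h
    rw [Fin.prod_univ_three] at h
    have hd2 : d 2 = 0 := by
      by_contra h2
      simp [h2] at h
    have hs := hwt d (mem_support_iff.mp hd)
    have he : Finsupp.single (0 : Fin 3) (N - 2 * d 1) + Finsupp.single (1 : Fin 3) (d 1) = d := by
      ext i
      fin_cases i
      · simp; omega
      · simp
      · simp [hd2]
    refine ⟨d 1, by simp; omega, ?_, he⟩
    rw [he]
    have : N - 2 * d 1 = d 0 := by omega
    rw [this]
    simpa [hd2] using h
  · intro j _ _
    rw [Fin.prod_univ_three]
    simp

lemma fold10 {F : Type*} [Field F] (h N : ℕ) (m : ℕ → F) (x : F) (hx : x ^ h = 1) (hN : N / 2 + 1 ≤ h + h + h)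
    (hm : ∀ j, N < 2 * j → m j = 0) :
    ∑ i ∈ Finset.range h, (m i + m (i + h) + m (i + h + h)) * x ^ i
      = ∑ j ∈ Finset.range (N / 2 + 1), m j * x ^ j := by
  have e : ∑ j ∈ Finset.range (N / 2 + 1), m j * x ^ j = ∑ j ∈ Finset.range (h + h + h), m j * x ^ j := by
    apply Finset.sum_subset
    · intro a; simp; omega
    · intro a _ ha
      rw [hm a (by simp at ha; omega), zero_mul]
  rw [e, Finset.sum_range_add, Finset.sum_range_add, ← Finset.sum_add_distrib, ← Finset.sum_add_distrib]
  apply Finset.sum_congr rfl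
  intro i _
  rw [show h + h + i = i + h + h by ring, show h + i = i + h by ring]
  simp only [pow_add, hx]
  ring

open MvPolynomial in
/-- Fix positive integers `r`, `k` and the sequence `c : ℤ → ℚ[α,β,γ]` as in the paper
(`α = X 0`, `β = X 1`, `γ = X 2`), with `P_k` the determinant of the `k×k` matrix with
`(i,j)` entry (1-based) `c (k+2r−1+j−i)`. Let `g` be a prime with
`g > k(k+2r−1)/3 + 1` and `g > 2k+2r−1`. Set `N := k(k+2r−1)` and
`w := ((g−1)!·2^{g−1})^k · P_k`. For `j ≥ 0`, let `M j` be the coefficient of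
`α^{N−2j}·β^j·γ^0` in `w` if `2j ≤ N`, and `0` otherwise. Let
`q(β) := Σ_{i=0}^{(g−3)/2} (M_i + M_{i+(g−1)/2} + M_{i+g−1})·β^i ∈ 𝔽_g[β]`
(coefficients reduced mod `g`). Then `q ≠ 0` and `q` has `k+r−1` pairwise distinct
nonzero roots in `𝔽_g`. -/
theorem stmt_10 (r k : ℕ) (hr : 1 ≤ r) (hk : 1 ≤ k)
    (g : ℕ) [Fact g.Prime]
    (hg1 : ((k * (k + 2 * r - 1) : ℕ) : ℚ) / 3 + 1 < (g : ℚ))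
    (hg2 : 2 * k + 2 * r - 1 < g)
    (c : ℤ → MvPolynomial (Fin 3) ℚ)
    (hneg : ∀ n : ℤ, n < 0 → c n = 0) (h0 : c 0 = 1)
    (hrec : ∀ n : ℤ, -3 ≤ n →
      C ((n : ℚ) + 4) * c (n + 4)
      + C (2 * (n : ℚ) + 6 - r) * X 0 * c (n + 3)
      + (C ((n : ℚ) + 2 - r) * (X 0) ^ 2
          + C ((2 * (n : ℚ) + 5 - 2 * r) / 4) * ((X 0) ^ 2 - X 1)) * c (n + 2)
      + (C ((2 * (n : ℚ) + 3 - 3 * r) / 4) * X 0 * ((X 0) ^ 2 - X 1)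
          + C (1 / 2 : ℚ) * X 2) * c (n + 1)
      + C (((n : ℚ) + 1 - 2 * r) / 16) * ((X 0) ^ 2 - X 1) ^ 2 * c n = 0)
    (P : MvPolynomial (Fin 3) ℚ)
    (hP : P = Matrix.det (Matrix.of fun i j : Fin k =>
      c ((k : ℤ) + 2 * r - 1 + j.val - i.val)))
    (w : MvPolynomial (Fin 3) ℚ)
    (hw : w = C (((Nat.factorial (g - 1) : ℚ) * 2 ^ (g - 1)) ^ k) * P)
    (M : ℕ → ℚ)
    (hM : ∀ j : ℕ, M j =
      if 2 * j ≤ k * (k + 2 * r - 1) then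
        MvPolynomial.coeff
          (Finsupp.single (0 : Fin 3) (k * (k + 2 * r - 1) - 2 * j)
            + Finsupp.single (1 : Fin 3) j) w
      else 0)
    (q : Polynomial (ZMod g))
    (hq : q = ∑ i ∈ Finset.range ((g - 3) / 2 + 1),
      Polynomial.C (((M i : ℚ) : ZMod g) + ((M (i + (g - 1) / 2) : ℚ) : ZMod g)
        + ((M (i + g - 1) : ℚ) : ZMod g)) * Polynomial.X ^ i) :
    q ≠ 0 ∧ ∃ S : Finset (ZMod g), S.card = k + r - 1 ∧
      ∀ x ∈ S, x ≠ 0 ∧ Polynomial.eval x q = 0 := by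
  have hgp : g.Prime := Fact.out
  have hg4 : 3 < g := by omega
  obtain ⟨h, hh⟩ : ∃ h, g = 2 * h + 1 := hgp.odd_of_ne_two (by omega)
  set N := k * (k + 2 * r - 1) with hN
  have hNg : N + 3 < 3 * g := by
    have : (N : ℚ) + 3 < 3 * g := by linarith
    exact_mod_cast this
  have hs : ((k + 2 * r - 1 : ℕ) : ℤ) = (k : ℤ) + 2 * r - 1 := by
    rw [Nat.cast_sub (by omega)]; push_cast; ring
  have hPhom : P ∈ weightedHomogeneousSubmodule ℚ (![1, 2, 3] : Fin 3 → ℤ) (N : ℤ) := by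
    have := det_hom10 k ((k : ℤ) + 2 * r - 1) c
      (fun n => c_hom10 r c hneg h0 hrec n.toNat n (by omega))
    rw [hP, hN, Nat.cast_mul, hs]
    exact this
  have hwhom : IsWeightedHomogeneous (![1, 2, 3] : Fin 3 → ℤ) w (N : ℤ) := by
    rw [hw, ← smul_eq_C_mul]
    exact Submodule.smul_mem _ _ hPhom
  have hPint : P ∈ (MvPolynomial.map (σ := Fin 3) (Rg10 g).subtype).range := by
    rw [hP, Matrix.det_apply]
    apply sum_mem
    intro σ _
    rw [Units.smul_def]
    apply zsmul_mem
    apply prod_mem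
    intro i _
    have hi := i.isLt
    have hi' := (σ i).isLt
    exact c_int10 r g (by omega) c hneg h0 hrec (g - 1) (by omega) _ (by omega)
  have hwint : w ∈ (MvPolynomial.map (σ := Fin 3) (Rg10 g).subtype).range := by
    rw [hw]
    refine mul_mem (C_mem10 g _ ?_) hPint
    exact pow_mem (mul_mem (natCast_mem _ _) (pow_mem (ofNat_mem _ 2) _)) _
  have hMint : ∀ j, M j ∈ Rg10 g := by
    intro j
    rw [hM]
    split_ifs
    · exact coeff_mem10 g w hwint _
    · exact zero_mem _
  set K : ℕ := (Nat.factorial (g - 1) * 2 ^ (g - 1)) ^ k with hK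
  have hK0 : (K : ZMod g) ≠ 0 := by
    rw [Ne, ZMod.natCast_eq_zero_iff, hK]
    intro hd
    rcases (Nat.Prime.dvd_mul hgp).mp (hgp.dvd_of_dvd_pow hd) with h1 | h1
    · have := (Nat.Prime.dvd_factorial hgp).mp h1
      omega
    · have := Nat.le_of_dvd (by omega) (hgp.dvd_of_dvd_pow h1)
      omega
  have main : ∀ (m : ℕ) (G : PowerSeries ℤ),
      (pB10 r m : PowerSeries ℤ) * G = (pA10 r m : PowerSeries ℤ) → PowerSeries.coeff 0 G = 1 →
      ((2 * m + 1 : ℕ) : ZMod g) ≠ 0 →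
      ((2 * m + 1 : ℕ) : ZMod g) ^ N * Polynomial.eval ((((2 * m + 1 : ℕ) : ZMod g)⁻¹) ^ 2) q
        = (K : ZMod g) * ((Matrix.det (Matrix.of fun i j : Fin k =>
          PowerSeries.coeff (k + 2 * r - 1 + j.val - i.val) G) : ℤ) : ZMod g) := by
    intro m G hG hG0 ht
    set D : ℤ := Matrix.det (Matrix.of fun i j : Fin k =>
          PowerSeries.coeff (k + 2 * r - 1 + j.val - i.val) G) with hD
    set t : ZMod g := ((2 * m + 1 : ℕ) : ZMod g) with htd
    have e1 : eval ![(2 * m + 1 : ℚ), 1, 0] w = (K : ℚ) * (D : ℚ) := by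
      rw [hw, map_mul, eval_C, hP, RingHom.map_det, hD, ← eq_intCast (Int.castRingHom ℚ), RingHom.map_det]
      congr 1
      · rw [hK]; push_cast; rfl
      · congr 1
        ext i j
        have hi := i.isLt
        simp only [RingHom.mapMatrix_apply, Matrix.map_apply, Matrix.of_apply]
        rw [eval_c10 r m hr G hG hG0 c hneg h0 hrec]
        have : (k : ℤ) + 2 * r - 1 + j.val - i.val = ((k + 2 * r - 1 + j.val - i.val : ℕ) : ℤ) := by omega
        rw [this, fc10_nat]
        rfl
    have e2 : ∑ j ∈ Finset.range (N / 2 + 1), M j * ((2 * m + 1 : ℕ) : ℚ) ^ (N - 2 * j) = (K : ℚ) * (D : ℚ) := by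
      rw [← e1, eval_w10 N w hwhom]
      apply Finset.sum_congr rfl
      intro j hj
      rw [hM, if_pos (by simp at hj; omega)]
      push_cast
      rfl
    have e3 : ∑ j ∈ Finset.range (N / 2 + 1), ((M j : ℚ) : ZMod g) * t ^ (N - 2 * j) = (K : ZMod g) * (D : ZMod g) := by
      have e2' : ∑ j ∈ Finset.range (N / 2 + 1), (⟨M j, hMint j⟩ : Rg10 g) * ((2 * m + 1 : ℕ) : Rg10 g) ^ (N - 2 * j)
          = (K : Rg10 g) * (D : Rg10 g) := by
        apply Subtype.ext
        push_cast at e2 ⊢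
        exact e2
      have := congrArg (phi10 g) e2'
      rw [map_sum, map_mul, map_natCast, map_intCast] at this
      rw [← this]
      apply Finset.sum_congr rfl
      intro j _
      rw [map_mul, map_pow, map_natCast]
      rfl
    rw [← e3]
    have hx : ((t⁻¹) ^ 2) ^ h = 1 := by
      rw [← pow_mul]
      have := ZMod.pow_card_sub_one_eq_one (inv_ne_zero ht)
      rwa [show g - 1 = 2 * h by omega] at this
    have hqe : Polynomial.eval (t⁻¹ ^ 2) q
        = ∑ j ∈ Finset.range (N / 2 + 1), ((M j : ℚ) : ZMod g) * (t⁻¹ ^ 2) ^ j := by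
      rw [← fold10 h N (fun j => ((M j : ℚ) : ZMod g)) (t⁻¹ ^ 2) hx (by omega) ?_]
      · rw [hq, Polynomial.eval_finsetSum, show (g - 3) / 2 + 1 = h by omega]
        apply Finset.sum_congr rfl
        intro i _
        rw [show (g - 1) / 2 = h by omega, show i + g - 1 = i + h + h by omega]
        simp only [Polynomial.eval_mul, Polynomial.eval_C, Polynomial.eval_pow, Polynomial.eval_X]
      · intro j hj
        rw [hM, if_neg (by omega)]
        simp
    rw [hqe, Finset.mul_sum]
    apply Finset.sum_congr rfl
    intro j hj
    have hj2 : 2 * j ≤ N := by simp at hj; omega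
    have : t ^ N * (t⁻¹ ^ 2) ^ j = t ^ (N - 2 * j) := by
      conv_lhs => rw [show N = (N - 2 * j) + 2 * j by omega]
      rw [pow_add, ← pow_mul, mul_assoc, ← mul_pow, mul_inv_cancel₀ ht, one_pow, mul_one]
    rw [← this]
    ring
  have hodd : ∀ m : ℕ, m < k + r → ((2 * m + 1 : ℕ) : ZMod g) ≠ 0 := by
    intro m hm
    rw [Ne, ZMod.natCast_eq_zero_iff]
    intro hd
    have := Nat.le_of_dvd (by omega) hd
    omega
  constructor
  · intro hq0
    obtain ⟨G, hG, hG0⟩ := exists_series10 r (r + k - 1)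
    have := main (r + k - 1) G hG hG0 (hodd _ (by omega))
    rw [hq0, Polynomial.eval_zero, mul_zero] at this
    exact mul_ne_zero hK0 (det_ne_zero_mod10 r k g hr hk hg2 G hG) this.symm
  · refine ⟨(Finset.range (k + r - 1)).image (fun m : ℕ => (((2 * m + 1 : ℕ) : ZMod g)⁻¹) ^ 2), ?_, ?_⟩
    · rw [Finset.card_image_of_injOn, Finset.card_range]
      intro a ha b hb hab
      simp only [Finset.coe_range, Set.mem_Iio] at ha hb
      simp only [inv_pow, inv_inj] at hab
      have hz : ((2 * a + 1 : ℕ) : ZMod g) ^ 2 - ((2 * b + 1 : ℕ) : ZMod g) ^ 2 = 0 := sub_eq_zero.mpr hab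
      have h2 : (2 : ZMod g) ≠ 0 := by
        have : ((2 : ℕ) : ZMod g) ≠ 0 := by
          rw [Ne, ZMod.natCast_eq_zero_iff]
          exact fun h => by have := Nat.le_of_dvd (by omega) h; omega
        exact_mod_cast this
      have h3 : ((a + b + 1 : ℕ) : ZMod g) ≠ 0 := by
        rw [Ne, ZMod.natCast_eq_zero_iff]
        exact fun h => by have := Nat.le_of_dvd (by omega) h; omega
      have hf : (2 * 2 * ((a + b + 1 : ℕ) : ZMod g)) * ((a : ZMod g) - b) = 0 := by
        push_cast at hz ⊢
        linear_combination hz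
      rcases mul_eq_zero.mp hf with h4 | h4
      · exact absurd h4 (mul_ne_zero (mul_ne_zero h2 h2) h3)
      · have h5 := sub_eq_zero.mp h4
        rw [ZMod.natCast_eq_natCast_iff'] at h5
        rwa [Nat.mod_eq_of_lt (by omega), Nat.mod_eq_of_lt (by omega)] at h5
    · intro x hx
      obtain ⟨m, hm, rfl⟩ := Finset.mem_image.mp hx
      have hm' : m < k + r - 1 := by simpa using hm
      have ht := hodd m (by omega)
      refine ⟨pow_ne_zero _ (inv_ne_zero ht), ?_⟩
      obtain ⟨G, hG, hG0⟩ := exists_series10 r m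
      have := main m G hG hG0 ht
      rw [det_zero10 r k m hr hk (by omega) G hG, Int.cast_zero, mul_zero] at this
      exact (mul_eq_zero.mp this).resolve_left (pow_ne_zero _ ht)
end

section
/- Let n ≥ 1 be an integer and z, a ∈ ℚ. Let D be the 2n×2n tridiagonal matrix over ℚ with diagonal entries D_{i,i} = z·(a+n+1−i) for 1 ≤ i ≤ 2n, superdiagonal entries D_{i,i+1} = 2n−i for 1 ≤ i ≤ 2n−1, subdiagonal entries D_{i,i−1} = i−1 for 2 ≤ i ≤ 2n, and all other entries 0. Then det D = ∏_{j=1}^{n} (z²·(a+j)·(a−j+1) − (2j−1)²). -/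
open Polynomial in
/-- Polynomial identity behind the conjugation to bidiagonal form. -/
lemma aux_poly (z t d N : ℝ) (ht : t ^ 2 + z * t - 1 = 0) (i : ℕ) :
    C (i : ℝ) * (X + C t) ^ (i - 1) + C (d - z * i) * (X + C t) ^ i
      + C (N - i) * (X + C t) ^ (i + 1)
    = C (d + N * t) * (X + C t) ^ i - C (z + 2 * t) * (X * derivative ((X + C t) ^ i))
      + C N * (X * (X + C t) ^ i) - X * (X * derivative ((X + C t) ^ i)) := by
  have h : (C t : ℝ[X]) ^ 2 + C z * C t - 1 = 0 := by
    rw [← C_pow, ← C_mul, ← C_add, ← C_1, ← C_sub, ht, C_0]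
  cases i with
  | zero => simp; ring
  | succ i =>
    simp only [derivative_X_add_C_pow, Nat.add_sub_cancel, C_sub, C_add, C_mul, Nat.cast_add,
      Nat.cast_one, C_1, C_ofNat, map_natCast]
    linear_combination (-((i : ℝ[X]) + 1) * (X + C t) ^ i) * h

/-- Entries of the (scaled) Pascal matrix. -/
noncomputable def auxL (t : ℝ) (i j : ℕ) : ℝ :=
  ((Polynomial.X + Polynomial.C t) ^ i).coeff j

open Polynomial in
lemma aux_coeff_X_der (p : ℝ[X]) (j : ℕ) : (X * derivative p).coeff j = j * p.coeff j := by
  cases j with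
  | zero => simp
  | succ j => rw [coeff_X_mul, coeff_derivative]; push_cast; ring

open Polynomial in
lemma auxL_rec (z t d N : ℝ) (ht : t ^ 2 + z * t - 1 = 0) (i j : ℕ) :
    i * auxL t (i - 1) j + (d - z * i) * auxL t i j + (N - i) * auxL t (i + 1) j
    = (d + N * t - (z + 2 * t) * j) * auxL t i j
      + (if 0 < j then (N - ((j - 1 : ℕ) : ℝ)) * auxL t i (j - 1) else 0) := by
  have h := congrArg (fun p => coeff p j) (aux_poly z t d N ht i)
  simp only [coeff_add, coeff_sub, coeff_C_mul, aux_coeff_X_der] at h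
  unfold auxL
  rw [h]
  cases j with
  | zero => simp
  | succ j =>
    simp only [coeff_X_mul, aux_coeff_X_der]
    simp
    ring

lemma aux_sum (m i : ℕ) (hi : i < m) (A B E : ℝ) (f : ℕ → ℝ) :
    ∑ k : Fin m, (if i = k.val then A else if i + 1 = k.val then B
      else if k.val + 1 = i then E else 0) * f k.val
    = A * f i + (if i + 1 < m then B * f (i + 1) else 0)
      + (if 0 < i then E * f (i - 1) else 0) := by
  rw [Fin.sum_univ_eq_sum_range (fun k => (if i = k then A else if i + 1 = k then B
      else if k + 1 = i then E else 0) * f k) m]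
  have h : ∀ k ∈ Finset.range m, (if i = k then A else if i + 1 = k then B
      else if k + 1 = i then E else 0) * f k
      = (if i = k then A * f k else 0) + (if i + 1 = k then B * f k else 0)
        + (if i - 1 = k then (if 0 < i then E * f k else 0) else 0) := by
    intro k _
    split_ifs <;> first | omega | simp
  rw [Finset.sum_congr rfl h, Finset.sum_add_distrib, Finset.sum_add_distrib,
    Finset.sum_ite_eq, Finset.sum_ite_eq, Finset.sum_ite_eq]
  have h1 : i - 1 < m := by omega
  simp [hi, h1]

lemma aux_prod (c s : ℝ) (n : ℕ) :
    ∏ k ∈ Finset.range (2 * n), (c + s * (2 * n - 1 - 2 * k) / 2)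
    = ∏ j ∈ Finset.range n, (c ^ 2 - s ^ 2 * (2 * j + 1) ^ 2 / 4) := by
  induction n with
  | zero => simp
  | succ n ih =>
    rw [Finset.prod_range_succ _ n, ← ih, show 2 * (n + 1) = 2 * n + 1 + 1 by ring,
      Finset.prod_range_succ, Finset.prod_range_succ', mul_assoc]
    congr 1
    · refine Finset.prod_congr rfl fun k _ => ?_
      push_cast; ring
    · push_cast; ring

lemma aux_det (n : ℕ) (z a : ℝ) :
    Matrix.det (Matrix.of fun i j : Fin (2 * n) =>
      if i = j then z * (a + (n : ℝ) - i.val)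
      else if i.val + 1 = j.val then 2 * (n : ℝ) - 1 - i.val
      else if j.val + 1 = i.val then (i.val : ℝ)
      else 0) =
    ∏ j ∈ Finset.range n,
      (z ^ 2 * (a + ((j : ℝ) + 1)) * (a - (j : ℝ)) - (2 * (j : ℝ) + 1) ^ 2) := by
  obtain ⟨s, hs⟩ : ∃ s : ℝ, s ^ 2 = z ^ 2 + 4 :=
    ⟨Real.sqrt (z ^ 2 + 4), Real.sq_sqrt (by positivity)⟩
  obtain ⟨t, rfl⟩ : ∃ t : ℝ, s = z + 2 * t := ⟨(s - z) / 2, by ring⟩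
  have ht : t ^ 2 + z * t - 1 = 0 := by linear_combination hs / 4
  set D : Matrix (Fin (2 * n)) (Fin (2 * n)) ℝ := Matrix.of fun i j : Fin (2 * n) =>
      if i = j then z * (a + (n : ℝ) - i.val)
      else if i.val + 1 = j.val then 2 * (n : ℝ) - 1 - i.val
      else if j.val + 1 = i.val then (i.val : ℝ)
      else 0 with hD
  let L : Matrix (Fin (2 * n)) (Fin (2 * n)) ℝ := Matrix.of fun i j => auxL t i j
  let u : ℕ → ℝ := fun j => z * (a + n) + (2 * n - 1) * t - (z + 2 * t) * j
  let U : Matrix (Fin (2 * n)) (Fin (2 * n)) ℝ := Matrix.of fun k j =>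
    if j.val = k.val then u j.val else if j.val + 1 = k.val then 0
      else if k.val + 1 = j.val then 2 * n - 1 - ((j.val - 1 : ℕ) : ℝ) else 0
  have hmul : D * L = L * U := by
    ext i j
    have e1 : (D * L) i j = z * (a + (n : ℝ) - i.val) * auxL t i j
        + (if i.val + 1 < 2 * n then (2 * (n : ℝ) - 1 - i.val) * auxL t (i + 1) j else 0)
        + (if 0 < i.val then (i.val : ℝ) * auxL t (i - 1) j else 0) := by
      rw [← aux_sum (2 * n) i.val i.isLt _ _ _ (fun k => auxL t k j), Matrix.mul_apply]
      simp only [hD, L, Matrix.of_apply, Fin.ext_iff]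
    have e2 : (L * U) i j = u j * auxL t i j
        + (if j.val + 1 < 2 * n then 0 * auxL t i (j + 1) else 0)
        + (if 0 < j.val then (2 * n - 1 - ((j.val - 1 : ℕ) : ℝ)) * auxL t i (j - 1) else 0) := by
      rw [← aux_sum (2 * n) j.val j.isLt _ _ _ (fun k => auxL t i k), Matrix.mul_apply]
      refine Finset.sum_congr rfl fun k _ => ?_
      rw [mul_comm]
      simp only [U, L, Matrix.of_apply]
    have e3 : (if i.val + 1 < 2 * n then (2 * (n : ℝ) - 1 - i.val) * auxL t (i + 1) j else 0)
        = (2 * (n : ℝ) - 1 - i.val) * auxL t (i + 1) j := by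
      split_ifs with h
      · rfl
      · have h2 : i.val + 1 = 2 * n := by omega
        have h3 : (i.val : ℝ) + 1 = 2 * n := by exact_mod_cast h2
        rw [← h3]; ring
    have e4 : (if 0 < i.val then (i.val : ℝ) * auxL t (i - 1) j else 0)
        = (i.val : ℝ) * auxL t (i - 1) j := by
      split_ifs with h
      · rfl
      · have h2 : i.val = 0 := by omega
        simp [h2]
    have h := auxL_rec z t (z * (a + n)) (2 * n - 1) ht i.val j.val
    rw [e1, e2, e3, e4]
    simp only [zero_mul, ite_self, add_zero, u]
    linear_combination h
  have hL : L.det = 1 := by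
    rw [Matrix.det_of_lowerTriangular]
    · refine Finset.prod_eq_one fun i _ => ?_
      simp [L, auxL, Polynomial.coeff_X_add_C_pow]
    · intro i j hij
      have : i.val < j.val := by simpa using hij
      simp [L, auxL, Polynomial.coeff_X_add_C_pow, Nat.choose_eq_zero_of_lt this]
  have hU : U.det = ∏ k ∈ Finset.range (2 * n), u k := by
    rw [Matrix.det_of_upperTriangular]
    · simp only [U, Matrix.of_apply, if_true]
      exact Fin.prod_univ_eq_prod_range u (2 * n)
    · intro i j hij
      have : j.val < i.val := by simpa using hij
      simp only [U, Matrix.of_apply]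
      split_ifs <;> first | omega | rfl
  have hdet := congrArg Matrix.det hmul
  rw [Matrix.det_mul, Matrix.det_mul, hL, mul_one, one_mul, hU] at hdet
  rw [hdet]
  have h1 := aux_prod (z * (a + 1 / 2)) (z + 2 * t) n
  calc _ = _ := Finset.prod_congr rfl fun k _ => by simp only [u]; ring
    _ = _ := h1
    _ = _ := Finset.prod_congr rfl fun j _ => by rw [hs]; ring

/-- Let `n ≥ 1`, `z, a ∈ ℚ`, and let `D` be the `2n×2n` tridiagonal matrix with
(1-based) diagonal entries `z·(a+n+1−i)`, superdiagonal entries `2n−i`, and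
subdiagonal entries `i−1`. Then
`det D = ∏_{j=1}^{n} (z²·(a+j)·(a−j+1) − (2j−1)²)`. -/
theorem stmt_14 (n : ℕ) (hn : 1 ≤ n) (z a : ℚ) :
    Matrix.det (Matrix.of fun i j : Fin (2 * n) =>
      if i = j then z * (a + (n : ℚ) - i.val)
      else if i.val + 1 = j.val then 2 * (n : ℚ) - 1 - i.val
      else if j.val + 1 = i.val then (i.val : ℚ)
      else 0) =
    ∏ j ∈ Finset.range n,
      (z ^ 2 * (a + ((j : ℚ) + 1)) * (a - (j : ℚ)) - (2 * (j : ℚ) + 1) ^ 2) := by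
  have h := aux_det n (z : ℝ) (a : ℝ)
  apply (Rat.castHom ℝ).injective
  rw [RingHom.map_det]
  refine Eq.trans ?_ (h.trans ?_)
  · congr 1
    ext i j
    simp only [RingHom.mapMatrix_apply, Matrix.map_apply, Matrix.of_apply]
    split_ifs <;> simp
  · simp
end
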